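/- arXiv:2605.02610 — 3 statements merged into one kernel-verified Lean document; each statement's English description precedes it below -/
import Mathlib

section
/- Let k > ℓ ≥ 2 and t ≥ k-1 be integers, and let G be an ℓ-graph in which every vertex is contained in at least C(t, k-1) copies of K_k^ℓ. If a vertex v satisfies deg_G(v) = C(t, ℓ-1), then there is a unique (t+1)-element set A containing v that is a copy of K_{t+1}^ℓ in G; moreover, every edge of G containing v is a subset of A. -/
open Finset

open scoped Classical

/-- `E` is the edge set of an `ℓ`-uniform hypergraph on vertex type `V`:
every edge is an `ℓ`-element set. -/
def IsLGraph {V : Type*} (ℓ : ℕ) (E : Finset (Finset V)) : Prop :=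
  ∀ e ∈ E, e.card = ℓ

/-- `S` is a copy of `K_k^ℓ` in the hypergraph with edge set `E`:
`S` has `k` vertices and every `ℓ`-element subset of `S` is an edge. -/
def IsCopy {V : Type*} (E : Finset (Finset V)) (ℓ k : ℕ) (S : Finset V) : Prop :=
  S.card = k ∧ ∀ e ⊆ S, e.card = ℓ → e ∈ E

/-- The number of copies of `K_k^ℓ` containing the vertex `v`. -/
noncomputable def copiesAt {V : Type*} [Fintype V] (E : Finset (Finset V)) (ℓ k : ℕ)
    (v : V) : ℕ :=
  ((univ : Finset (Finset V)).filter fun S => v ∈ S ∧ IsCopy E ℓ k S).card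

/-- The degree of a vertex: the number of edges containing it. -/
noncomputable def hdeg {V : Type*} (E : Finset (Finset V)) (v : V) : ℕ :=
  (E.filter fun e => v ∈ e).card

/-- The `(t,k)`-degree condition: every vertex is contained in at least
`C(t, k-1)` copies of `K_k^ℓ`. -/
def DegCond {V : Type*} [Fintype V] (E : Finset (Finset V)) (ℓ k t : ℕ) : Prop :=
  ∀ v : V, Nat.choose t (k - 1) ≤ copiesAt E ℓ k v

/-- `E` is extremal: it is an `ℓ`-graph satisfying the `(t,k)`-degree condition
with the minimum number of edges among all such `ℓ`-graphs on the same vertex set. -/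
def IsExtremal {V : Type*} [Fintype V] (E : Finset (Finset V)) (ℓ k t : ℕ) : Prop :=
  IsLGraph ℓ E ∧ DegCond E ℓ k t ∧
    ∀ E' : Finset (Finset V), IsLGraph ℓ E' → DegCond E' ℓ k t → E.card ≤ E'.card

/-- `A` is an isolated copy of `K_{t+1}^ℓ`: it is a copy of `K_{t+1}^ℓ` and
every edge meeting `A` is contained in `A`. -/
def IsIsolatedCopy {V : Type*} [DecidableEq V] (E : Finset (Finset V)) (ℓ t : ℕ)
    (A : Finset V) : Prop :=
  IsCopy E ℓ (t + 1) A ∧ ∀ e ∈ E, (e ∩ A).Nonempty → e ⊆ A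

/-- The family of all copies of `K_k^ℓ` in the hypergraph with edge set `E`. -/
noncomputable def copies {V : Type*} [Fintype V] (E : Finset (Finset V)) (ℓ k : ℕ) :
    Finset (Finset V) :=
  univ.filter (IsCopy E ℓ k)

section

variable {V : Type*}

lemma mem_copies [Fintype V] {E : Finset (Finset V)} {ℓ k : ℕ} {S : Finset V} :
    S ∈ copies E ℓ k ↔ IsCopy E ℓ k S := by
  simp [copies]

lemma isLGraph_copies [Fintype V] (E : Finset (Finset V)) (ℓ k : ℕ) :
    IsLGraph k (copies E ℓ k) := fun _ hS => (mem_copies.1 hS).1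

lemma copies_succ_subset [Fintype V] (E : Finset (Finset V)) (ℓ j : ℕ) :
    copies E ℓ (j + 1) ⊆ copies (copies E ℓ j) j (j + 1) := by
  intro S hS
  rw [mem_copies] at hS ⊢
  exact ⟨hS.1, fun e he hc => mem_copies.2 ⟨hc, fun f hf => hS.2 f (hf.trans he)⟩⟩

lemma copies_powersetCard_subset [Fintype V] {s m : ℕ} (hs : 1 ≤ s) (hm : s ≤ m)
    (A : Finset V) : copies (powersetCard s A) s m ⊆ powersetCard m A := by
  intro S hS
  obtain ⟨hc, hS⟩ := mem_copies.1 hS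
  refine mem_powersetCard.2 ⟨fun x hx => ?_, hc⟩
  obtain ⟨e, hxe, heS, hec⟩ := exists_subsuperset_card_eq (singleton_subset_iff.2 hx)
    (by simpa using hs) (hc.symm ▸ hm)
  exact (mem_powersetCard.1 (hS e heS hec)).1 (singleton_subset_iff.1 hxe)

variable [DecidableEq V]

lemma card_memberSubfamily (v : V) (G : Finset (Finset V)) :
    #(memberSubfamily v G) = #(G.filter fun e => v ∈ e) := by
  have h := card_memberSubfamily_add_card_nonMemberSubfamily v G
  have h' := card_filter_add_card_filter_not (s := G) (fun e => v ∈ e)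
  rw [nonMemberSubfamily] at h
  omega

lemma sum_card_memberSubfamily [Fintype V] {ℓ : ℕ} {G : Finset (Finset V)}
    (hG : IsLGraph ℓ G) : ∑ v, #(memberSubfamily v G) = ℓ * #G := by
  simp_rw [card_memberSubfamily, card_filter]
  rw [sum_comm]
  simp only [sum_boole, Nat.cast_id, filter_univ_mem]
  rw [sum_congr rfl hG, sum_const, smul_eq_mul, mul_comm]

lemma IsLGraph.memberSubfamily {ℓ : ℕ} {G : Finset (Finset V)} (hG : IsLGraph (ℓ + 1) G)
    (v : V) : IsLGraph ℓ (memberSubfamily v G) := by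
  intro e he
  rw [mem_memberSubfamily] at he
  have := hG _ he.1
  rw [card_insert_of_notMem he.2] at this
  omega

lemma memberSubfamily_copies_subset_copies [Fintype V] (G : Finset (Finset V)) (ℓ k : ℕ)
    (v : V) : memberSubfamily v (copies G (ℓ + 1) (k + 1)) ⊆
      copies (memberSubfamily v G) ℓ k := by
  intro S hS
  rw [mem_memberSubfamily, mem_copies] at hS
  obtain ⟨⟨hc, hS⟩, hv⟩ := hS
  rw [card_insert_of_notMem hv] at hc
  refine mem_copies.2 ⟨by omega, fun e he hec => ?_⟩
  have hve : v ∉ e := fun h => hv (he h)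
  rw [mem_memberSubfamily]
  exact ⟨hS _ (insert_subset_insert _ he) (by rw [card_insert_of_notMem hve, hec]), hve⟩

lemma memberSubfamily_copies_subset_nonMemberSubfamily [Fintype V] (G : Finset (Finset V))
    (ℓ : ℕ) (v : V) :
    memberSubfamily v (copies G ℓ (ℓ + 1)) ⊆ nonMemberSubfamily v G := by
  intro S hS
  rw [mem_memberSubfamily, mem_copies] at hS
  obtain ⟨⟨hc, hS⟩, hv⟩ := hS
  rw [card_insert_of_notMem hv] at hc
  rw [mem_nonMemberSubfamily]
  exact ⟨hS _ (subset_insert _ _) (by omega), hv⟩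

lemma card_memberSubfamily_copies_add_le [Fintype V] (G : Finset (Finset V)) (ℓ : ℕ) (v : V) :
    #(memberSubfamily v (copies G ℓ (ℓ + 1))) + #(memberSubfamily v G) ≤ #G := by
  have h1 := card_le_card (memberSubfamily_copies_subset_nonMemberSubfamily G ℓ v)
  have h2 := card_memberSubfamily_add_card_nonMemberSubfamily v G
  omega

lemma local_bound_of_choose_le {r y κ d g : ℕ} (h : κ + d ≤ g)
    (hg : g ≤ y.choose (r + 1)) (hd : (y - 1).choose r ≤ d) :
    (r + 1) * (κ + d) ≤ y * d ∧
      ((r + 1) * (κ + d) = y * d → κ + d = g ∧ g = y.choose (r + 1)) := by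
  have key : (r + 1) * y.choose (r + 1) = y * (y - 1).choose r := by
    cases y with
    | zero => simp
    | succ n =>
      have := Nat.add_one_mul_choose_eq n r
      simp only [Nat.add_sub_cancel]
      linarith
  have h1 : (r + 1) * (κ + d) ≤ (r + 1) * g := Nat.mul_le_mul_left _ h
  have h2 : (r + 1) * g ≤ (r + 1) * y.choose (r + 1) := Nat.mul_le_mul_left _ hg
  have h3 : y * (y - 1).choose r ≤ y * d := Nat.mul_le_mul_left _ hd
  refine ⟨by omega, fun he => ⟨?_, ?_⟩⟩
  · exact Nat.eq_of_mul_eq_mul_left (show 0 < r + 1 by omega) (by omega)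
  · exact Nat.eq_of_mul_eq_mul_left (show 0 < r + 1 by omega) (by omega)

/-- Summing the local inequalities at the vertices bounds the number of copies of
`K_{r+2}^{r+1}`; equality forces equality at every vertex. -/
lemma card_copies_bound_of_local [Fintype V] {r y : ℕ} {G : Finset (Finset V)}
    (hG : IsLGraph (r + 1) G)
    (hloc : ∀ v, (r + 1) * (#(memberSubfamily v (copies G (r + 1) (r + 2))) +
      #(memberSubfamily v G)) ≤ y * #(memberSubfamily v G)) :
    (r + 2) * #(copies G (r + 1) (r + 2)) + (r + 1) * #G ≤ y * #G ∧
      ((r + 2) * #(copies G (r + 1) (r + 2)) + (r + 1) * #G = y * #G →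
        ∀ v, (r + 1) * (#(memberSubfamily v (copies G (r + 1) (r + 2))) +
          #(memberSubfamily v G)) = y * #(memberSubfamily v G)) := by
  have hs1 : ∑ v, (r + 1) * (#(memberSubfamily v (copies G (r + 1) (r + 2))) +
      #(memberSubfamily v G)) =
      (r + 1) * ((r + 2) * #(copies G (r + 1) (r + 2)) + (r + 1) * #G) := by
    rw [← mul_sum, sum_add_distrib, sum_card_memberSubfamily hG,
      sum_card_memberSubfamily (isLGraph_copies G (r + 1) (r + 2))]
  have hs2 : ∑ v, y * #(memberSubfamily v G) = (r + 1) * (y * #G) := by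
    rw [← mul_sum, sum_card_memberSubfamily hG]
    ring
  refine ⟨?_, fun h v => ?_⟩
  · have := sum_le_sum fun v (_ : v ∈ univ) => hloc v
    rw [hs1, hs2] at this
    exact Nat.le_of_mul_le_mul_left this (Nat.succ_pos r)
  · refine (sum_eq_sum_iff_of_le fun v _ => hloc v).1 ?_ v (mem_univ v)
    rw [hs1, hs2, h]

lemma local_bound [Fintype V] (r : ℕ) : ∀ (y : ℕ) (G : Finset (Finset V)),
    IsLGraph (r + 1) G → #G ≤ y.choose (r + 1) → ∀ v : V,
    (r + 1) * (#(memberSubfamily v (copies G (r + 1) (r + 2))) +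
      #(memberSubfamily v G)) ≤ y * #(memberSubfamily v G) ∧
    (0 < #(memberSubfamily v G) →
      (r + 1) * (#(memberSubfamily v (copies G (r + 1) (r + 2))) +
        #(memberSubfamily v G)) = y * #(memberSubfamily v G) →
      #(memberSubfamily v (copies G (r + 1) (r + 2))) + #(memberSubfamily v G) = #G ∧
        #G = y.choose (r + 1)) := by
  induction r with
  | zero =>
    intro y G hG hy v
    by_cases hd : (y - 1).choose 0 ≤ #(memberSubfamily v G)
    · have := local_bound_of_choose_le (card_memberSubfamily_copies_add_le G 1 v) hy hd
      exact ⟨this.1, fun _ => this.2⟩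
    · rw [Nat.choose_zero_right, not_le, Nat.lt_one_iff] at hd
      have hκ : memberSubfamily v (copies G 1 2) = ∅ := by
        refine eq_empty_of_forall_notMem fun S hS => ?_
        have h := (mem_copies.1 (memberSubfamily_copies_subset_copies G 0 1 v hS)).2 ∅
          (empty_subset _) rfl
        rw [card_eq_zero.1 hd] at h
        exact notMem_empty _ h
      simp [hκ, hd]
  | succ r ih =>
    intro y G hG hy v
    by_cases hd : (y - 1).choose (r + 1) ≤ #(memberSubfamily v G)
    · have := local_bound_of_choose_le (card_memberSubfamily_copies_add_le G (r + 2) v) hy hd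
      exact ⟨this.1, fun _ => this.2⟩
    · have hL := hG.memberSubfamily v
      rw [not_le] at hd
      have ih' := ih (y - 1) _ hL hd.le
      have hb := card_copies_bound_of_local hL fun w => (ih' w).1
      have hsub := card_le_card (memberSubfamily_copies_subset_copies G (r + 1) (r + 2) v)
      have hmul := Nat.mul_le_mul_left (r + 2) hsub
      rcases Nat.eq_zero_or_pos y with rfl | hy0
      · have hG0 : #G = 0 := by simpa using hy
        have h : #(memberSubfamily v (copies G (r + 1 + 1) (r + 1 + 2))) +
          #(memberSubfamily v G) ≤ #G := card_memberSubfamily_copies_add_le G (r + 2) v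
        have h1 : #(memberSubfamily v G) = 0 := by omega
        have h2 : #(memberSubfamily v (copies G (r + 1 + 1) (r + 1 + 2))) = 0 := by
          omega
        simp [h1, h2]
      obtain ⟨z, rfl⟩ : ∃ z, y = z + 1 := ⟨y - 1, by omega⟩
      simp only [Nat.add_sub_cancel] at hb hd ih'
      have hle : (r + 1 + 1) * (#(memberSubfamily v (copies G (r + 1 + 1) (r + 1 + 2))) +
          #(memberSubfamily v G)) ≤ (z + 1) * #(memberSubfamily v G) := by
        have := hb.1
        have h3 : r + 1 + 2 = r + 2 + 1 := by ring
        rw [h3]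
        nlinarith
      refine ⟨hle, fun hpos heq => ?_⟩
      exfalso
      have heq' : (r + 2) * #(copies (memberSubfamily v G) (r + 1) (r + 2)) +
          (r + 1) * #(memberSubfamily v G) = z * #(memberSubfamily v G) := by
        refine le_antisymm hb.1 ?_
        have h3 : r + 1 + 2 = r + 2 + 1 := by ring
        rw [h3] at heq
        nlinarith
      have hall := hb.2 heq'
      obtain ⟨w, -, hw⟩ : ∃ w ∈ (univ : Finset V),
          0 < #(memberSubfamily w (memberSubfamily v G)) := by
        refine (sum_pos_iff).1 ?_
        rw [sum_card_memberSubfamily hL]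
        positivity
      exact hd.ne ((ih' w).2 hw (hall w)).2

lemma card_copies_bound [Fintype V] {r y : ℕ} {G : Finset (Finset V)}
    (hG : IsLGraph (r + 1) G) (hy : #G ≤ y.choose (r + 1)) :
    (r + 2) * #(copies G (r + 1) (r + 2)) + (r + 1) * #G ≤ y * #G :=
  (card_copies_bound_of_local hG fun v => (local_bound r y G hG hy v).1).1

lemma succ_mul_choose_add (t j : ℕ) (hj : j ≤ t) :
    (j + 1) * t.choose (j + 1) + j * t.choose j = t * t.choose j := by
  have h := Nat.choose_succ_right_eq t j
  obtain ⟨c, rfl⟩ := Nat.exists_eq_add_of_le hj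
  rw [Nat.add_sub_cancel_left] at h
  nlinarith

lemma choose_lt_choose_of_lt {a b r : ℕ} (hab : a < b) (hb : r + 1 ≤ b) :
    a.choose (r + 1) < b.choose (r + 1) := by
  obtain ⟨c, rfl⟩ : ∃ c, b = c + 1 := ⟨b - 1, by omega⟩
  have h1 : a.choose (r + 1) ≤ c.choose (r + 1) := Nat.choose_le_choose _ (by omega)
  have h2 : 0 < c.choose r := Nat.choose_pos (by omega)
  rw [Nat.choose_succ_succ' c r]
  omega

/-- If every edge extends to a copy of `K_{ℓ+1}^ℓ` by any non-isolated vertex outside it,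
then the hypergraph is complete on its set of non-isolated vertices. -/
lemma eq_powersetCard_of_forall_isCopy_insert {ℓ : ℕ} {G : Finset (Finset V)}
    (hG : IsLGraph ℓ G) (hne : G.Nonempty)
    (h : ∀ v ∈ G.biUnion id, ∀ e ∈ G, v ∉ e → IsCopy G ℓ (ℓ + 1) (insert v e)) :
    G = powersetCard ℓ (G.biUnion id) := by
  ext e
  rw [mem_powersetCard]
  refine ⟨fun he => ⟨subset_biUnion_of_mem id he, hG e he⟩, fun ⟨heA, hec⟩ => ?_⟩
  obtain ⟨f, hf, hmax⟩ := exists_max_image G (fun f => #(f ∩ e)) hne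
  have hfc := hG f hf
  by_cases hef : e ⊆ f
  · rwa [eq_of_subset_of_card_le hef (by omega)]
  exfalso
  obtain ⟨v, hve, hvf⟩ := not_subset.1 hef
  have hfe : ¬ f ⊆ e := fun hfe => hef (eq_of_subset_of_card_le hfe (by omega)).ge
  obtain ⟨w, hwf, hwe⟩ := not_subset.1 hfe
  have hmem : (insert v f).erase w ∈ G := by
    refine (h v (heA hve) f hf hvf).2 _ (erase_subset _ _) ?_
    rw [card_erase_of_mem (mem_insert_of_mem hwf), card_insert_of_notMem hvf]
    omega
  have hlt : #(f ∩ e) < #((insert v f).erase w ∩ e) := by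
    refine card_lt_card ((ssubset_iff_of_subset fun x hx => ?_).2
      ⟨v, ?_, fun hx => hvf (mem_inter.1 hx).1⟩)
    · simp only [mem_inter, mem_erase, mem_insert] at hx ⊢
      exact ⟨⟨fun hxw => hwe (hxw ▸ hx.2), Or.inr hx.1⟩, hx.2⟩
    · exact mem_inter.2
        ⟨mem_erase.2 ⟨fun hvw => hwe (hvw ▸ hve), mem_insert_self v f⟩, hve⟩
  exact absurd (hmax _ hmem) (not_le.2 hlt)

/-- Uniqueness in the Kruskal–Katona theorem for one level: an `(r+1)`-graph with at most
`C(t, r+1)` edges and at least `C(t, r+2)` copies of `K_{r+2}^{r+1}` is complete on `t` vertices. -/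
lemma exists_eq_powersetCard_of_choose_le [Fintype V] {r t : ℕ} (ht : r + 2 ≤ t)
    {G : Finset (Finset V)} (hG : IsLGraph (r + 1) G) (hy : #G ≤ t.choose (r + 1))
    (hK : t.choose (r + 2) ≤ #(copies G (r + 1) (r + 2))) :
    ∃ A : Finset V, #A = t ∧ G = powersetCard (r + 1) A := by
  have hloc := local_bound r t G hG hy
  have hb := card_copies_bound_of_local hG fun v => (hloc v).1
  have hc := succ_mul_choose_add t (r + 1) (by omega)
  have hK' := Nat.mul_le_mul_left (r + 2) hK
  obtain ⟨c, hct⟩ := Nat.exists_eq_add_of_le (show r + 1 ≤ t by omega)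
  have hc' : (r + 2) * t.choose (r + 2) = c * t.choose (r + 1) := by
    have : t * t.choose (r + 1) = (r + 1) * t.choose (r + 1) + c * t.choose (r + 1) := by
      conv_lhs => rw [hct, add_mul]
      rw [← hct]
    linarith
  have hy' := Nat.mul_le_mul_left c hy
  have heq : (r + 2) * #(copies G (r + 1) (r + 2)) + (r + 1) * #G = t * #G := by
    refine le_antisymm hb.1 ?_
    have : t * #G = (r + 1) * #G + c * #G := by rw [hct, add_mul]
    linarith
  have hall := hb.2 heq
  have hne : G.Nonempty := by
    rw [nonempty_iff_ne_empty]
    rintro rfl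
    simp only [card_empty, mul_zero, add_zero, mul_eq_zero, card_eq_zero] at heq
    have h0 : 0 < t.choose (r + 2) := Nat.choose_pos ht
    rcases heq with heq | heq
    · omega
    · rw [heq, card_empty] at hK
      omega
  have hdeg : ∀ v ∈ G.biUnion id, 0 < #(memberSubfamily v G) := by
    intro v hv
    obtain ⟨e, he, hve⟩ := mem_biUnion.1 hv
    rw [card_memberSubfamily]
    exact card_pos.2 ⟨e, mem_filter.2 ⟨he, hve⟩⟩
  have hGA : G = powersetCard (r + 1) (G.biUnion id) := by
    refine eq_powersetCard_of_forall_isCopy_insert hG hne fun v hv e he hve => ?_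
    have h1 := ((hloc v).2 (hdeg v hv) (hall v)).1
    have h2 := card_memberSubfamily_add_card_nonMemberSubfamily v G
    have h3 := eq_of_subset_of_card_le
      (memberSubfamily_copies_subset_nonMemberSubfamily G (r + 1) v) (by
        change _ ≤ #(memberSubfamily v (copies G (r + 1) (r + 2)))
        omega)
    have h4 : e ∈ memberSubfamily v (copies G (r + 1) (r + 1 + 1)) := by
      rw [h3, mem_nonMemberSubfamily]
      exact ⟨he, hve⟩
    exact mem_copies.1 (mem_memberSubfamily.1 h4).1
  refine ⟨G.biUnion id, ?_, hGA⟩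
  obtain ⟨e, he⟩ := hne
  have hGc : #G = t.choose (r + 1) := by
    obtain ⟨v, hv⟩ : e.Nonempty := card_pos.1 (by rw [hG e he]; omega)
    exact ((hloc v).2 (hdeg v (mem_biUnion.2 ⟨e, he, hv⟩)) (hall v)).2
  rw [hGA, card_powersetCard] at hGc
  have heA : r + 1 ≤ #(G.biUnion id) := by
    rw [← hG e he]
    exact card_le_card (subset_biUnion_of_mem id he)
  rcases lt_trichotomy #(G.biUnion id) t with h | h | h
  · exact absurd hGc (choose_lt_choose_of_lt h (by omega)).ne
  · exact h
  · exact absurd hGc (choose_lt_choose_of_lt h heA).ne'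

/-- Uniqueness in the Kruskal–Katona theorem for several levels. -/
lemma exists_eq_powersetCard_of_choose_le_copies [Fintype V] {r m t : ℕ} (hm : r + 2 ≤ m)
    (ht : m ≤ t) {G : Finset (Finset V)} (hG : IsLGraph (r + 1) G)
    (hy : #G ≤ t.choose (r + 1)) (hK : t.choose m ≤ #(copies G (r + 1) m)) :
    ∃ A : Finset V, #A = t ∧ G = powersetCard (r + 1) A := by
  refine exists_eq_powersetCard_of_choose_le (hm.trans ht) hG hy ?_
  by_contra! hlt
  have hstep : ∀ j, r + 2 ≤ j → j ≤ t → #(copies G (r + 1) j) < t.choose j := by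
    intro j hj
    induction j, hj using Nat.le_induction with
    | base => exact fun _ => hlt
    | succ j hj ih =>
      intro hjt
      have ih' := ih (by omega)
      obtain ⟨i, rfl⟩ : ∃ i, j = i + 1 := ⟨j - 1, by omega⟩
      have hb := card_copies_bound (isLGraph_copies G (r + 1) (i + 1)) ih'.le
      have hsub := card_le_card (copies_succ_subset G (r + 1) (i + 1))
      have hc := succ_mul_choose_add t (i + 1) (by omega)
      obtain ⟨c, hct⟩ := Nat.exists_eq_add_of_le hjt
      by_contra! hge
      have h1 := Nat.mul_le_mul_left (i + 2) (hge.trans hsub)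
      have h2 : (c + 1) * #(copies G (r + 1) (i + 1)) < (c + 1) * t.choose (i + 1) :=
        Nat.mul_lt_mul_of_pos_left ih' (Nat.succ_pos c)
      have h3 : ∀ x, t * x = (i + 1) * x + (c + 1) * x := fun x => by rw [hct]; ring
      rw [h3] at hb hc
      simp only [add_assoc, Nat.reduceAdd] at *
      linarith
  exact absurd (hstep m hm ht) (not_lt.2 hK)

end

/-- In an `ℓ`-graph satisfying the `(t,k)`-degree condition, a vertex of degree exactly
`C(t, ℓ-1)` lies in a unique copy of `K_{t+1}^ℓ`, and every edge through the vertex is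
contained in that copy. -/
theorem stmt14 (k ℓ t : ℕ) (hkl : ℓ < k) (hl : 2 ≤ ℓ) (ht : k - 1 ≤ t)
    (V : Type*) [DecidableEq V] [Fintype V]
    (E : Finset (Finset V)) (hE : IsLGraph ℓ E) (hdc : DegCond E ℓ k t)
    (v : V) (hv : hdeg E v = Nat.choose t (ℓ - 1)) :
    ∃ A : Finset V, (v ∈ A ∧ IsCopy E ℓ (t + 1) A) ∧
      (∀ e ∈ E, v ∈ e → e ⊆ A) ∧
      ∀ B : Finset V, v ∈ B → IsCopy E ℓ (t + 1) B → B = A := by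
  obtain ⟨r, rfl⟩ : ∃ r, ℓ = r + 2 := ⟨ℓ - 2, by omega⟩
  obtain ⟨m, rfl⟩ : ∃ m, k = m + 1 := ⟨k - 1, by omega⟩
  have hd : #(memberSubfamily v E) = t.choose (r + 1) := by
    rw [card_memberSubfamily]
    unfold hdeg at hv
    convert hv using 3
    omega
  have hK : t.choose m ≤ #(memberSubfamily v (copies E (r + 2) (m + 1))) := by
    rw [card_memberSubfamily, copies, filter_filter]
    have h := hdc v
    unfold copiesAt at h
    simp_rw [and_comm (a := v ∈ _)] at h
    convert h using 3
    omega
  have hsub := memberSubfamily_copies_subset_copies E (r + 1) m v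
  obtain ⟨A, hA, hLA⟩ := exists_eq_powersetCard_of_choose_le_copies (by omega) ht
    (hE.memberSubfamily v) hd.le (hK.trans (card_le_card hsub))
  rw [hLA] at hsub
  have hcop : memberSubfamily v (copies E (r + 2) (m + 1)) = powersetCard m A :=
    eq_of_subset_of_card_le
      (hsub.trans (copies_powersetCard_subset (by omega) (by omega) A))
      (by rwa [card_powersetCard, hA])
  have hvA : v ∉ A := by
    intro hvA
    obtain ⟨e, hve, heA, hec⟩ := exists_subsuperset_card_eq (n := r + 1)
      (singleton_subset_iff.2 hvA) (by simp) (by omega)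
    have : e ∈ memberSubfamily v E := hLA ▸ mem_powersetCard.2 ⟨heA, hec⟩
    exact (mem_memberSubfamily.1 this).2 (singleton_subset_iff.1 hve)
  have hsubA : ∀ e ∈ E, v ∈ e → e ⊆ insert v A := by
    intro e he hve
    have : e.erase v ∈ powersetCard (r + 1) A := by
      rw [← hLA, mem_memberSubfamily, insert_erase hve]
      exact ⟨he, notMem_erase v e⟩
    exact subset_insert_iff.2 (mem_powersetCard.1 this).1
  refine ⟨insert v A, ⟨mem_insert_self v A, ?_, fun e he hec => ?_⟩, hsubA, ?_⟩
  · rw [card_insert_of_notMem hvA, hA]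
  · have heA : e.erase v ⊆ A := subset_insert_iff.1 he
    have hle : #(e.erase v) ≤ m := (card_erase_le).trans (by omega)
    obtain ⟨T, heT, hTA, hTc⟩ := exists_subsuperset_card_eq heA hle (by omega)
    have hT : T ∈ memberSubfamily v (copies E (r + 2) (m + 1)) :=
      hcop ▸ mem_powersetCard.2 ⟨hTA, hTc⟩
    exact (mem_copies.1 (mem_memberSubfamily.1 hT).1).2 e (subset_insert_iff.2 heT) hec
  · intro B hvB hB
    refine eq_of_subset_of_card_le (fun x hx => ?_) ?_
    · obtain ⟨e, hpe, heB, hec⟩ := exists_subsuperset_card_eq (n := r + 2)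
        (show ({v, x} : Finset V) ⊆ B from insert_subset hvB (singleton_subset_iff.2 hx))
        (card_le_two.trans (by omega)) (by rw [hB.1]; omega)
      exact hsubA e (hB.2 e heB hec) (hpe (by simp)) (hpe (by simp))
    · rw [card_insert_of_notMem hvA, hA, hB.1]
end

section
/- Let k > ℓ ≥ 2 and t ≥ k-1 be integers, let n ≥ t+1, and let G be an extremal ℓ-graph on n vertices for the (t,k)-degree condition. Then the number of vertices v of G with deg_G(v) > C(t, ℓ-1) is at most (1/4)(t+1)²·C(t-1, ℓ-2). -/
open Finset

open scoped Classical

/-- The Lovász form of the Kruskal–Katona theorem on an arbitrary finite type, for any family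
containing the iterated shadow. -/
theorem choose_le_card_of_iterated_shadow_subset {α : Type*} [Fintype α] {r i m : ℕ}
    (hir : i ≤ r) (hrm : r ≤ m) (hm : m ≤ Fintype.card α) {A B : Finset (Finset α)}
    (hA : ∀ S ∈ A, S.card = r) (hcard : m.choose r ≤ A.card)
    (hB : ∀ S ∈ A, ∀ s ⊆ S, s.card = r - i → s ∈ B) : m.choose (r - i) ≤ B.card := by
  let f := Fintype.equivFin α
  have hsized : ((A.map f.finsetCongr.toEmbedding : Finset (Finset (Fin _))) :
      Set (Finset (Fin (Fintype.card α)))).Sized r := by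
    intro S hS
    simp only [coe_map, Set.mem_image, mem_coe] at hS
    obtain ⟨T, hT, rfl⟩ := hS
    simpa using hA T hT
  refine (kruskal_katona_lovasz_form hir hrm hm hsized (by simpa using hcard)).trans ?_
  rw [← card_map f.finsetCongr.toEmbedding (s := B)]
  refine card_le_card fun s hs ↦ ?_
  rw [mem_shadow_iterate_iff_exists_mem_card_add] at hs
  obtain ⟨S, hS, hsS, hc⟩ := hs
  obtain ⟨T, hT, rfl⟩ := mem_map.1 hS
  refine mem_map.2 ⟨f.symm.finsetCongr s, hB T hT _ ?_ ?_, ?_⟩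
  · intro x hx
    simp only [Equiv.finsetCongr_apply, mem_map_equiv, Equiv.symm_symm] at hx
    simpa [mem_map_equiv] using hsS hx
  · have := hA T hT
    simp only [Equiv.coe_toEmbedding, Equiv.finsetCongr_apply, card_map] at hc ⊢
    omega
  · simp [← Equiv.finsetCongr_symm]

/-- A vertex in at least `C(t, k-1)` copies of `K_k^ℓ` has degree at least `C(t, ℓ-1)`. -/
theorem choose_le_hdeg {V : Type*} [Fintype V] {E : Finset (Finset V)} {k ℓ t : ℕ}
    (hkl : ℓ < k) (hl : 1 ≤ ℓ) (ht : k - 1 ≤ t) (hn : t ≤ Fintype.card V) {v : V}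
    (hv : t.choose (k - 1) ≤ copiesAt E ℓ k v) : t.choose (ℓ - 1) ≤ hdeg E v := by
  have key := choose_le_card_of_iterated_shadow_subset (r := k - 1) (i := k - ℓ) (m := t)
    (A := ((univ : Finset (Finset V)).filter fun S ↦ v ∈ S ∧ IsCopy E ℓ k S).image
      fun S ↦ S.erase v)
    (B := (E.filter fun e ↦ v ∈ e).image fun e ↦ e.erase v) (by omega) ht hn ?_ ?_ ?_
  · rw [show k - 1 - (k - ℓ) = ℓ - 1 by omega] at key
    exact key.trans card_image_le
  · intro S hS
    obtain ⟨T, hT, rfl⟩ := mem_image.1 hS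
    obtain ⟨-, hvT, hT⟩ := mem_filter.1 hT
    rw [card_erase_of_mem hvT, hT.1]
  · rwa [card_image_of_injOn]
    intro S hS T hT h
    exact erase_injOn' v (by simp_all) (by simp_all) h
  · intro S hS s hs hcard
    obtain ⟨T, hT, rfl⟩ := mem_image.1 hS
    obtain ⟨-, hvT, hT⟩ := mem_filter.1 hT
    have hvs : v ∉ s := fun h ↦ by simpa using hs h
    refine mem_image.2 ⟨insert v s, mem_filter.2 ⟨hT.2 _ ?_ ?_, mem_insert_self _ _⟩,
      erase_insert hvs⟩
    · exact insert_subset hvT (hs.trans (erase_subset _ _))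
    · rw [card_insert_of_notMem hvs]
      omega

/-- A vertex of a clique on `t+1` vertices lies in at least `C(t, k-1)` copies of `K_k^ℓ`. -/
theorem choose_le_copiesAt {V : Type*} [Fintype V] {E : Finset (Finset V)} {k ℓ t : ℕ}
    (hk : 1 ≤ k) {v : V} {A : Finset V} (hv : v ∈ A) (hA : A.card = t + 1)
    (hAE : powersetCard ℓ A ⊆ E) : t.choose (k - 1) ≤ copiesAt E ℓ k v := by
  have hc : (A.erase v).card = t := by rw [card_erase_of_mem hv, hA, Nat.add_sub_cancel]
  rw [← hc, ← card_powersetCard]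
  refine card_le_card_of_injOn (fun T ↦ insert v T) ?_ ?_
  · intro T hT
    obtain ⟨hTA, hT⟩ := mem_powersetCard.1 hT
    have hvT : v ∉ T := fun h ↦ by simpa using hTA h
    have hsub : insert v T ⊆ A := insert_subset hv (hTA.trans (erase_subset _ _))
    refine mem_filter.2 ⟨mem_univ _, mem_insert_self _ _, ?_, fun e he hcard ↦
      hAE (mem_powersetCard.2 ⟨he.trans hsub, hcard⟩)⟩
    rw [card_insert_of_notMem hvT]
    omega
  · intro S hS T hT h
    have hvS : v ∉ S := fun h ↦ by simpa using (mem_powersetCard.1 hS).1 h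
    have hvT : v ∉ T := fun h ↦ by simpa using (mem_powersetCard.1 hT).1 h
    rw [← erase_insert hvS, ← erase_insert hvT]
    exact congrArg (fun U ↦ erase U v) h

theorem choose_le_choose_add_mul (a m d : ℕ) :
    (m + d).choose (a + 1) ≤ m.choose (a + 1) + d * (m + d - 1).choose a := by
  induction d with
  | zero => simp
  | succ d ih =>
    have h1 : (m + d - 1).choose a ≤ (m + d).choose a := Nat.choose_le_choose _ (by omega)
    rw [← add_assoc, Nat.choose_succ_succ', Nat.add_sub_cancel]
    linarith [Nat.mul_le_mul_left d h1]

/-- The excess degree created by letting two cliques on `b+2` vertices overlap in `s` vertices. -/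
theorem four_mul_overlap_le (a b s : ℕ) (hs : s ≤ b + 2) :
    4 * (s * (b + 1).choose (a + 1)) ≤
      4 * ((a + 2) * s.choose (a + 2)) + (b + 2) ^ 2 * b.choose a := by
  rcases s with _ | m
  · simp
  obtain ⟨d, hd⟩ : ∃ d, b + 1 = m + d := ⟨b + 1 - m, by omega⟩
  have h1 := choose_le_choose_add_mul a m d
  rw [← hd, Nat.add_sub_cancel] at h1
  have h2 := Nat.add_one_mul_choose_eq m (a + 1)
  have h3 : 4 * ((m + 1) * d) ≤ (b + 2) ^ 2 := by
    have : b + 2 = (m + 1) + d := by omega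
    rw [this]
    nlinarith [four_mul_le_sq_add (m + 1) d]
  have h4 := Nat.mul_le_mul_left (4 * (m + 1)) h1
  have h5 := Nat.mul_le_mul_right (b.choose a) h3
  linarith

/-- Every set of at least `b+2` vertices can be covered by cliques on `b+2` vertices using
few edges. -/
theorem exists_clique_cover {V : Type*} (a b : ℕ) (W : Finset V) (hW : b + 2 ≤ W.card) :
    ∃ E : Finset (Finset V), IsLGraph (a + 2) E ∧
      (∀ v ∈ W, ∃ A, v ∈ A ∧ A.card = b + 2 ∧ powersetCard (a + 2) A ⊆ E) ∧
      4 * ((a + 2) * E.card) ≤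
        4 * (W.card * (b + 1).choose (a + 1)) + (b + 2) ^ 2 * b.choose a := by
  classical
  have hch := Nat.add_one_mul_choose_eq (b + 1) (a + 1)
  obtain ⟨A, hAW, hA⟩ := exists_subset_card_eq hW
  induction h : W.card using Nat.strong_induction_on generalizing W A with
  | _ n ih =>
  subst h
  by_cases hle : W.card ≤ 2 * (b + 2)
  · obtain ⟨B, hWB, hBW, hB⟩ := exists_subsuperset_card_eq (n := b + 2)
      (sdiff_subset : W \ A ⊆ W) (by rw [card_sdiff_of_subset hAW]; omega) hW
    have hun : A ∪ B = W := by
      refine (union_subset hAW hBW).antisymm fun x hx ↦ ?_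
      by_cases hxA : x ∈ A
      · exact mem_union_left _ hxA
      · exact mem_union_right _ (hWB (mem_sdiff.2 ⟨hx, hxA⟩))
    refine ⟨powersetCard (a + 2) A ∪ powersetCard (a + 2) B, ?_, ?_, ?_⟩
    · intro e he
      rcases mem_union.1 he with he | he <;> exact (mem_powersetCard.1 he).2
    · intro v hv
      rcases mem_union.1 (hun ▸ hv) with hv | hv
      · exact ⟨A, hv, hA, subset_union_left⟩
      · exact ⟨B, hv, hB, subset_union_right⟩
    · have hint : powersetCard (a + 2) A ∩ powersetCard (a + 2) B
          = powersetCard (a + 2) (A ∩ B) := by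
        ext e
        simp only [mem_inter, mem_powersetCard, subset_inter_iff]
        tauto
      have h1 := card_union_add_card_inter (powersetCard (a + 2) A) (powersetCard (a + 2) B)
      rw [hint, card_powersetCard, card_powersetCard, card_powersetCard, hA, hB] at h1
      have h2 := card_union_add_card_inter A B
      rw [hun, hA, hB] at h2
      have h3 := four_mul_overlap_le a b (A ∩ B).card (by omega)
      have h4 := congrArg (fun x ↦ x * (b + 1).choose (a + 1)) h2
      have h5 := congrArg (fun x ↦ (a + 2) * x) h1
      linarith
  · have hcard : (W \ A).card + (b + 2) = W.card := by
      rw [card_sdiff_of_subset hAW]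
      omega
    obtain ⟨A', hAW', hA'⟩ := exists_subset_card_eq (s := W \ A) (n := b + 2) (by omega)
    obtain ⟨E, hE, hcov, hbd⟩ := ih _ (by omega) (W \ A) (by omega) A' hAW' hA' rfl
    refine ⟨E ∪ powersetCard (a + 2) A, ?_, ?_, ?_⟩
    · intro e he
      rcases mem_union.1 he with he | he
      · exact hE e he
      · exact (mem_powersetCard.1 he).2
    · intro v hv
      by_cases hvA : v ∈ A
      · exact ⟨A, hvA, hA, subset_union_right⟩
      · obtain ⟨B, hvB, hB, hBE⟩ := hcov v (mem_sdiff.2 ⟨hv, hvA⟩)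
        exact ⟨B, hvB, hB, hBE.trans subset_union_left⟩
    · have h1 := card_union_le E (powersetCard (a + 2) A)
      rw [card_powersetCard, hA] at h1
      have h2 := Nat.mul_le_mul_left (4 * (a + 2)) h1
      rw [← hcard]
      linarith

theorem sum_hdeg {V : Type*} [Fintype V] {ℓ : ℕ} {E : Finset (Finset V)} (hE : IsLGraph ℓ E) :
    ∑ v, hdeg E v = ℓ * E.card := by
  simp only [hdeg, card_filter]
  rw [sum_comm, sum_congr rfl fun e he ↦ ?_, sum_const, smul_eq_mul, mul_comm]
  rw [← card_filter, filter_univ_mem, hE e he]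

/-- In an extremal `ℓ`-graph on `n ≥ t+1` vertices, the number of vertices of degree
exceeding `C(t, ℓ-1)` is at most `(1/4)(t+1)² C(t-1, ℓ-2)`. -/
theorem stmt15 (k ℓ t : ℕ) (hkl : ℓ < k) (hl : 2 ≤ ℓ) (ht : k - 1 ≤ t)
    (V : Type*) [DecidableEq V] [Fintype V] (hn : t + 1 ≤ Fintype.card V)
    (E : Finset (Finset V)) (hE : IsExtremal E ℓ k t) :
    ((((univ : Finset V).filter fun v => Nat.choose t (ℓ - 1) < hdeg E v).card : ℕ) : ℚ) ≤
      (((t + 1) ^ 2 * Nat.choose (t - 1) (ℓ - 2) : ℕ) : ℚ) / 4 := by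
  obtain ⟨hEl, hdc, hmin⟩ := hE
  obtain ⟨a, rfl⟩ : ∃ a, ℓ = a + 2 := ⟨ℓ - 2, by omega⟩
  obtain ⟨b, rfl⟩ : ∃ b, t = b + 1 := ⟨t - 1, by omega⟩
  obtain ⟨E', hE', hcov, hbd⟩ := exists_clique_cover a b (univ : Finset V) hn
  have hle : E.card ≤ E'.card := hmin E' hE' fun v ↦ by
    obtain ⟨A, hvA, hA, hAE⟩ := hcov v (mem_univ v)
    exact choose_le_copiesAt (by omega) hvA hA hAE
  have hsum : ∑ v : V, ((b + 1).choose (a + 1) +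
      if (b + 1).choose (a + 1) < hdeg E v then 1 else 0) ≤ ∑ v, hdeg E v := by
    refine sum_le_sum fun v _ ↦ ?_
    have : (b + 1).choose (a + 1) ≤ hdeg E v :=
      choose_le_hdeg hkl (by omega) ht (by omega) (hdc v)
    split_ifs <;> omega
  rw [sum_hdeg hEl, sum_add_distrib, sum_const, smul_eq_mul, ← card_filter] at hsum
  have hle' := Nat.mul_le_mul_left (a + 2) hle
  rw [le_div_iff₀ (by norm_num)]
  norm_cast
  simp only [show a + 2 - 1 = a + 1 by omega, Nat.add_sub_cancel]
  linarith
end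

section
/- For all integers k > ℓ ≥ 2 there exists an integer t₀ such that for every integer t ≥ t₀ the following holds. Let n > (1/4)(t+1)²·C(t-1, ℓ-2) + 2t and let G be an extremal ℓ-graph on n vertices for the (t,k)-degree condition that contains no isolated copy of K_{t+1}^ℓ. Then G contains two disjoint (t+1)-element vertex sets A₁ and A₂ that are both copies of K_{t+1}^ℓ in G. -/
open Finset

open scoped Classical

/-- The copies of `K_m^s` in `H`. -/
noncomputable def cliques {V : Type*} [Fintype V] (H : Finset (Finset V)) (s m : ℕ) :
    Finset (Finset V) :=
  univ.filter (IsCopy H s m)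

/-- The link of `v` in `H`. -/
noncomputable def link {V : Type*} (H : Finset (Finset V)) (v : V) : Finset (Finset V) :=
  (H.filter fun e ↦ v ∈ e).image fun e ↦ e.erase v

section

variable {V : Type*}

theorem mem_link {H : Finset (Finset V)} {v : V} {e : Finset V} :
    e ∈ link H v ↔ v ∉ e ∧ insert v e ∈ H := by
  simp only [link, mem_image, mem_filter]
  constructor
  · rintro ⟨f, ⟨hf, hv⟩, rfl⟩
    exact ⟨notMem_erase v f, by rwa [insert_erase hv]⟩
  · rintro ⟨hv, he⟩
    exact ⟨insert v e, ⟨he, mem_insert_self v e⟩, erase_insert hv⟩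

theorem card_link (H : Finset (Finset V)) (v : V) :
    (link H v).card = (H.filter fun e ↦ v ∈ e).card := by
  refine card_image_of_injOn fun e he f hf h ↦ ?_
  replace he := mem_filter.1 (mem_coe.1 he)
  replace hf := mem_filter.1 (mem_coe.1 hf)
  rw [← insert_erase he.2, ← insert_erase hf.2]
  exact congrArg _ h

theorem isLGraph_link {H : Finset (Finset V)} {s : ℕ} (hH : IsLGraph (s + 1) H) (v : V) :
    IsLGraph s (link H v) := by
  intro e he
  rw [mem_link] at he
  have := hH _ he.2
  rw [card_insert_of_notMem he.1] at this
  omega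

theorem IsCopy.erase_link {H : Finset (Finset V)} {s m : ℕ} {S : Finset V} {v : V}
    (hS : IsCopy H (s + 1) (m + 1) S) (hv : v ∈ S) : IsCopy (link H v) s m (S.erase v) := by
  refine ⟨by rw [card_erase_of_mem hv, hS.1]; rfl, fun e he hc ↦ ?_⟩
  have hve : v ∉ e := fun h ↦ notMem_erase v S (he h)
  refine mem_link.2 ⟨hve, hS.2 _ (insert_subset hv (he.trans (erase_subset v S))) ?_⟩
  rw [card_insert_of_notMem hve, hc]

theorem isCopy_powersetCard {s m : ℕ} {S N : Finset V} (hs : 1 ≤ s) (hsm : s ≤ m)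
    (hS : IsCopy (powersetCard s N) s m S) : S ⊆ N := by
  intro x hx
  obtain ⟨e, hxe, heS, he⟩ := exists_subsuperset_card_eq (singleton_subset_iff.2 hx)
    (by simpa using hs) (hS.1 ▸ hsm)
  exact (mem_powersetCard.1 (hS.2 e heS he)).1 (hxe (mem_singleton_self x))

theorem card_powersetCard_filter_superset {S T : Finset V} (hTS : T ⊆ S) {m : ℕ}
    (hm : T.card ≤ m) :
    ((powersetCard m S).filter fun e ↦ T ⊆ e).card
      = (S.card - T.card).choose (m - T.card) := by
  rw [← card_sdiff_of_subset hTS, ← card_powersetCard]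
  refine card_bij' (fun e _ ↦ e \ T) (fun e _ ↦ e ∪ T) ?_ ?_ ?_ ?_
  · intro e he
    obtain ⟨he, hT⟩ := mem_filter.1 he
    obtain ⟨he, hc⟩ := mem_powersetCard.1 he
    exact mem_powersetCard.2 ⟨sdiff_subset_sdiff he Subset.rfl, by
      rw [card_sdiff_of_subset hT, hc]⟩
  · intro e he
    obtain ⟨he, hc⟩ := mem_powersetCard.1 he
    have hdis : Disjoint e T := disjoint_of_subset_left he sdiff_disjoint
    refine mem_filter.2 ⟨mem_powersetCard.2 ⟨union_subset (he.trans sdiff_subset) hTS, ?_⟩,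
      subset_union_right⟩
    rw [card_union_of_disjoint hdis, hc]
    omega
  · intro e he
    exact sdiff_union_of_subset (mem_filter.1 he).2
  · intro e he
    have hdis : Disjoint e T :=
      disjoint_of_subset_left (mem_powersetCard.1 he).1 sdiff_disjoint
    rw [union_sdiff_right, sdiff_eq_self_of_disjoint hdis]

theorem isCopy_of_powersetCard_subset {E : Finset (Finset V)} {ℓ m : ℕ} {B : Finset V}
    (hB : B.card = m) (h : powersetCard ℓ B ⊆ E) : IsCopy E ℓ m B :=
  ⟨hB, fun _ he hc ↦ h (mem_powersetCard.2 ⟨he, hc⟩)⟩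

theorem choose_succ_le_add_mul (s m r : ℕ) :
    (m + r).choose (s + 1) ≤ m.choose (s + 1) + r * (m + r - 1).choose s := by
  induction r with
  | zero => simp
  | succ r ih =>
    have h1 : (m + r - 1).choose s ≤ (m + r).choose s := Nat.choose_le_choose s (by omega)
    have h2 := Nat.mul_le_mul_left r h1
    rw [← add_assoc, Nat.choose_succ_succ', Nat.add_sub_cancel, add_mul]
    omega

/-- The degree excess of two copies of `K_{t+1}^ℓ` sharing `a` vertices. -/
theorem overlap_excess_le {ℓ t a : ℕ} (hl : 2 ≤ ℓ) (ha : 1 ≤ a) (hat : a ≤ t + 1) :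
    4 * (a * t.choose (ℓ - 1))
      ≤ 4 * (ℓ * a.choose ℓ) + (t + 1) ^ 2 * (t - 1).choose (ℓ - 2) := by
  obtain ⟨s, rfl⟩ : ∃ s, ℓ = s + 2 := ⟨ℓ - 2, by omega⟩
  obtain ⟨m, rfl⟩ : ∃ m, a = m + 1 := ⟨a - 1, by omega⟩
  obtain ⟨r, rfl⟩ : ∃ r, t = m + r := ⟨t - m, by omega⟩
  simp only [show s + 2 - 1 = s + 1 by omega, Nat.add_sub_cancel]
  have h1 := choose_succ_le_add_mul s m r
  have h2 := Nat.add_one_mul_choose_eq m (s + 1)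
  generalize (m + r - 1).choose s = c at *
  have h3 : 4 * ((m + 1) * r) ≤ (m + r + 1) ^ 2 := by
    zify
    nlinarith [sq_nonneg ((m : ℤ) + 1 - r)]
  have h4 := Nat.mul_le_mul_right c h3
  have h5 := Nat.mul_le_mul_left (m + 1) h1
  rw [show s + 2 = s + 1 + 1 from rfl]
  nlinarith

/-- Any set of at least `t + 1` vertices is covered by copies of `K_{t+1}^ℓ` with few edges. -/
theorem exists_sparse_cover {ℓ t : ℕ} (hl : 2 ≤ ℓ) (W : Finset V) (hW : t + 1 ≤ W.card) :
    ∃ E : Finset (Finset V), IsLGraph ℓ E ∧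
      (∀ v ∈ W, ∃ B : Finset V, v ∈ B ∧ IsCopy E ℓ (t + 1) B) ∧
      4 * (ℓ * E.card)
        ≤ 4 * (W.card * t.choose (ℓ - 1)) + (t + 1) ^ 2 * (t - 1).choose (ℓ - 2) := by
  have hid : ℓ * (t + 1).choose ℓ = (t + 1) * t.choose (ℓ - 1) := by
    obtain ⟨s, rfl⟩ : ∃ s, ℓ = s + 1 := ⟨ℓ - 1, by omega⟩
    rw [Nat.add_sub_cancel, mul_comm]
    exact (Nat.add_one_mul_choose_eq t s).symm
  induction W using Finset.strongInduction with
  | H W ih =>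
    rcases lt_or_ge W.card (2 * (t + 1)) with h | h
    · obtain ⟨B, hBW, hB⟩ := exists_subset_card_eq hW
      obtain ⟨C, hCW, hCW', hC⟩ := exists_subsuperset_card_eq (sdiff_subset (s := W) (t := B))
        (by rw [card_sdiff_of_subset hBW]; omega : _ ≤ t + 1) hW
      have hunion : B ∪ C = W := by
        refine (union_subset hBW hCW').antisymm fun x hx ↦ ?_
        by_cases hxB : x ∈ B
        · exact mem_union_left _ hxB
        · exact mem_union_right _ (hCW (mem_sdiff.2 ⟨hx, hxB⟩))
      have hcard := card_union_add_card_inter B C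
      rw [hunion, hB, hC] at hcard
      refine ⟨powersetCard ℓ B ∪ powersetCard ℓ C, fun e he ↦ ?_, fun v hv ↦ ?_, ?_⟩
      · rcases mem_union.1 he with h | h <;> exact (mem_powersetCard.1 h).2
      · rw [← hunion] at hv
        rcases mem_union.1 hv with h | h
        · exact ⟨B, h, isCopy_of_powersetCard_subset hB subset_union_left⟩
        · exact ⟨C, h, isCopy_of_powersetCard_subset hC subset_union_right⟩
      · have h1 := card_union_add_card_inter (powersetCard ℓ B) (powersetCard ℓ C)
        have h2 : powersetCard ℓ B ∩ powersetCard ℓ C = powersetCard ℓ (B ∩ C) := by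
          ext e
          simp only [mem_inter, mem_powersetCard, subset_inter_iff]
          tauto
        rw [h2, card_powersetCard, card_powersetCard, card_powersetCard, hB, hC] at h1
        have h3 := overlap_excess_le (a := (B ∩ C).card) (t := t) hl (by omega) (by omega)
        have h4 := congrArg (ℓ * ·) h1
        have h5 := congrArg (· * t.choose (ℓ - 1)) hcard
        simp only [mul_add, add_mul] at h4 h5 hid ⊢
        omega
    · obtain ⟨B, hBW, hB⟩ := exists_subset_card_eq hW
      have hc : (W \ B).card + (t + 1) = W.card := by
        rw [card_sdiff_of_subset hBW]
        omega
      obtain ⟨E, hE, hcov, hcard⟩ := ih (W \ B)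
        (sdiff_ssubset hBW (card_pos.1 (by omega))) (by omega)
      refine ⟨E ∪ powersetCard ℓ B, fun e he ↦ ?_, fun v hv ↦ ?_, ?_⟩
      · exact (mem_union.1 he).elim (hE e) fun h ↦ (mem_powersetCard.1 h).2
      · by_cases hvB : v ∈ B
        · exact ⟨B, hvB, isCopy_of_powersetCard_subset hB subset_union_right⟩
        · obtain ⟨C, hvC, hC⟩ := hcov v (mem_sdiff.2 ⟨hv, hvB⟩)
          exact ⟨C, hvC, hC.1, fun e he h ↦ mem_union_left _ (hC.2 e he h)⟩
      · have h1 := card_union_le E (powersetCard ℓ B)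
        rw [card_powersetCard, hB] at h1
        have h2 := Nat.mul_le_mul_left ℓ h1
        have h3 := congrArg (· * t.choose (ℓ - 1)) hc
        simp only [mul_add, add_mul] at h2 h3 hid ⊢
        omega

variable [Fintype V]

theorem sum_card_filter_mem {m : ℕ} {F : Finset (Finset V)} (hF : IsLGraph m F) :
    ∑ v : V, (F.filter fun e ↦ v ∈ e).card = m * F.card := by
  have := sum_card_bipartiteAbove_eq_sum_card_bipartiteBelow
    (s := (univ : Finset V)) (t := F) (fun v e ↦ v ∈ e)
  simp only [bipartiteAbove, bipartiteBelow] at this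
  rw [this, sum_congr rfl (g := fun _ ↦ m) fun e he ↦ by simpa using hF e he, sum_const,
    smul_eq_mul, mul_comm]

theorem isLGraph_cliques (H : Finset (Finset V)) (s m : ℕ) : IsLGraph m (cliques H s m) :=
  fun _ hS ↦ (mem_filter.1 hS).2.1

theorem card_cliques_mem_le_link (H : Finset (Finset V)) (s m : ℕ) (v : V) :
    ((cliques H (s + 1) (m + 1)).filter fun S ↦ v ∈ S).card ≤ (cliques (link H v) s m).card := by
  rw [← card_link]
  refine card_le_card fun T hT ↦ ?_
  obtain ⟨S, hS, rfl⟩ := mem_image.1 hT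
  obtain ⟨hS, hv⟩ := mem_filter.1 hS
  exact mem_filter.2 ⟨mem_univ _, (mem_filter.1 hS).2.erase_link hv⟩

theorem card_cliques_mem_add_le (H : Finset (Finset V)) (s : ℕ) (v : V) :
    ((cliques H s (s + 1)).filter fun S ↦ v ∈ S).card + (H.filter fun e ↦ v ∈ e).card
      ≤ H.card := by
  rw [← card_filter_add_card_filter_not (s := H) (fun e ↦ v ∈ e), add_comm,
    ← card_link (cliques H s (s + 1))]
  refine Nat.add_le_add_left (card_le_card fun T hT ↦ ?_) _
  obtain ⟨S, hS, rfl⟩ := mem_image.1 hT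
  obtain ⟨hS, hv⟩ := mem_filter.1 hS
  have hS := (mem_filter.1 hS).2
  exact mem_filter.2 ⟨hS.2 _ (erase_subset v S) (by rw [card_erase_of_mem hv, hS.1]; rfl),
    notMem_erase v S⟩

/-- The clique form of the Lovász version of the Kruskal-Katona theorem, with equality case. -/
theorem card_cliques_succ {s : ℕ} (hs : 1 ≤ s) : ∀ {t : ℕ}, s ≤ t → ∀ {H : Finset (Finset V)},
    IsLGraph s H → H.card ≤ t.choose s →
    (s + 1) * (cliques H s (s + 1)).card ≤ (t - s) * H.card ∧
    ((s + 1) * (cliques H s (s + 1)).card = (t - s) * H.card →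
      H = ∅ ∨ ∃ N : Finset V, N.card = t ∧ H = powersetCard s N) := by
  induction s, hs using Nat.le_induction with
  | base =>
    intro t ht H hH hcard
    set U : Finset V := univ.filter fun x ↦ {x} ∈ H with hU
    have hHU : H = powersetCard 1 U := by
      ext e
      rw [mem_powersetCard]
      constructor
      · intro he
        obtain ⟨x, rfl⟩ := card_eq_one.1 (hH e he)
        simpa [hU] using he
      · rintro ⟨he, hc⟩
        obtain ⟨x, rfl⟩ := card_eq_one.1 hc
        simpa [hU] using he
    have hUH : H.card = U.card := by
      conv_lhs => rw [hHU, card_powersetCard, Nat.choose_one_right]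
    have hK : (cliques H 1 (1 + 1)).card ≤ U.card.choose 2 := by
      rw [← card_powersetCard]
      refine card_le_card fun S hS ↦ ?_
      have hS := (mem_filter.1 hS).2
      exact mem_powersetCard.2 ⟨isCopy_powersetCard le_rfl one_le_two (hHU ▸ hS), hS.1⟩
    have h2 : 2 * U.card.choose 2 = (U.card - 1) * U.card := by
      rw [Nat.choose_two_right, Nat.mul_div_cancel' (Nat.even_mul_pred_self _).two_dvd, mul_comm]
    rw [Nat.choose_one_right, hUH] at hcard
    rw [hUH]
    have h3 : (U.card - 1) * U.card ≤ (t - 1) * U.card := Nat.mul_le_mul_right _ (by omega)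
    refine ⟨by omega, fun h ↦ ?_⟩
    rcases Nat.eq_zero_or_pos U.card with h0 | h0
    · exact .inl (card_eq_zero.1 (hUH.trans h0))
    · have := Nat.eq_of_mul_eq_mul_right h0 (show (U.card - 1) * U.card = (t - 1) * U.card by omega)
      exact .inr ⟨U, by omega, hHU⟩
  | succ s hs ih =>
    intro t ht H hH hcard
    obtain ⟨t, rfl⟩ : ∃ r, t = r + 1 := ⟨t - 1, by omega⟩
    have hst : s ≤ t := by omega
    rw [Nat.add_sub_add_right]
    set K := cliques H (s + 1) (s + 1 + 1) with hK
    have hid := Nat.add_one_mul_choose_eq t s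
    have hpos : 0 < t.choose s := Nat.choose_pos hst
    obtain ⟨r, rfl⟩ : ∃ r, t = s + r := ⟨t - s, by omega⟩
    rw [Nat.add_sub_cancel_left]
    have hloc : ∀ v : V, (s + 1) * (K.filter fun S ↦ v ∈ S).card
          ≤ r * (H.filter fun e ↦ v ∈ e).card ∧
        ((s + 1) * (K.filter fun S ↦ v ∈ S).card = r * (H.filter fun e ↦ v ∈ e).card →
          (H.filter fun e ↦ v ∈ e).card = 0 ∨
          (H.filter fun e ↦ v ∈ e).card = (s + r).choose s ∧
            H.card = (s + r + 1).choose (s + 1)) := by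
      intro v
      rcases lt_or_ge (H.filter fun e ↦ v ∈ e).card ((s + r).choose s) with h | h
      · have h1 := card_cliques_mem_le_link H s (s + 1) v
        rw [← hK] at h1
        obtain ⟨h2, h3⟩ := ih hst (isLGraph_link hH v) (by rw [card_link]; exact h.le)
        rw [card_link, Nat.add_sub_cancel_left] at h2 h3
        have h4 := (Nat.mul_le_mul_left (s + 1) h1).trans h2
        refine ⟨h4, fun h5 ↦ ?_⟩
        have h6 := Nat.mul_le_mul_left (s + 1) h1
        rcases h3 (by omega) with h7 | ⟨N, hN, h7⟩
        · exact .inl (by rw [← card_link, h7, card_empty])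
        · have h8 := congrArg card h7
          rw [card_link, card_powersetCard, hN] at h8
          omega
      · have h1 := card_cliques_mem_add_le H (s + 1) v
        rw [← hK] at h1
        generalize (K.filter fun S ↦ v ∈ S).card = κ at *
        generalize (H.filter fun e ↦ v ∈ e).card = d at *
        refine ⟨by nlinarith, fun h5 ↦ .inr ?_⟩
        have h6 : (s + r + 1) * d ≤ (s + r + 1) * (s + r).choose s := by nlinarith
        have h7 : d = (s + r).choose s := le_antisymm (Nat.le_of_mul_le_mul_left h6 (by omega)) h
        refine ⟨h7, le_antisymm hcard ?_⟩
        subst h7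
        refine Nat.le_of_mul_le_mul_right (c := s + 1) ?_ (by omega)
        nlinarith
    have hsK := sum_card_filter_mem (isLGraph_cliques H (s + 1) (s + 1 + 1))
    rw [← hK] at hsK
    have hsH := sum_card_filter_mem hH
    have hle := sum_le_sum fun (v : V) (_ : v ∈ univ) ↦ (hloc v).1
    have hleq := sum_eq_sum_iff_of_le fun (v : V) (_ : v ∈ univ) ↦ (hloc v).1
    rw [← mul_sum, ← mul_sum, hsK, hsH] at hle hleq
    refine ⟨Nat.le_of_mul_le_mul_left (c := s + 1) (by linarith) (by omega), fun heq ↦ ?_⟩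
    have hall := hleq.1 (by rw [heq]; ring)
    rcases H.eq_empty_or_nonempty with h0 | ⟨e, he⟩
    · exact .inl h0
    right
    set N : Finset V := univ.filter fun v ↦ (H.filter fun e ↦ v ∈ e).card ≠ 0 with hN
    have hmem : ∀ e ∈ H, ∀ v ∈ e, v ∈ N := fun e he v hv ↦
      mem_filter.2 ⟨mem_univ v, card_ne_zero_of_mem (mem_filter.2 ⟨he, hv⟩)⟩
    have hdeg : ∀ v ∈ N, (H.filter fun e ↦ v ∈ e).card = (s + r).choose s ∧
        H.card = (s + r + 1).choose (s + 1) := fun v hv ↦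
      ((hloc v).2 (hall v (mem_univ v))).resolve_left (mem_filter.1 hv).2
    obtain ⟨x, hx⟩ := card_pos.1 (by rw [hH e he]; omega : 0 < e.card)
    have hHc := (hdeg x (hmem e he x hx)).2
    have hsum : ∑ v ∈ N, (H.filter fun e ↦ v ∈ e).card = (s + 1) * H.card := by
      rw [← hsH]
      exact sum_filter_ne_zero univ
    rw [sum_congr rfl fun v hv ↦ (hdeg v hv).1, sum_const, smul_eq_mul, hHc] at hsum
    have hNc : N.card = s + r + 1 := Nat.eq_of_mul_eq_mul_right hpos (by linarith)
    refine ⟨N, hNc, eq_of_subset_of_card_le (fun f hf ↦ ?_) ?_⟩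
    · exact mem_powersetCard.2 ⟨fun v hv ↦ hmem f hf v hv, hH f hf⟩
    · rw [card_powersetCard, hNc, hHc]

theorem IsCopy.cliques_succ {H : Finset (Finset V)} {s m : ℕ} {S : Finset V}
    (hS : IsCopy H s m S) : IsCopy (cliques H s (s + 1)) (s + 1) m S :=
  ⟨hS.1, fun _ he hc ↦ mem_filter.2 ⟨mem_univ _, hc, fun f hf ↦ hS.2 f (hf.trans he)⟩⟩

theorem card_cliques_le_cliques_succ (H : Finset (Finset V)) (s m : ℕ) :
    (cliques H s m).card ≤ (cliques (cliques H s (s + 1)) (s + 1) m).card :=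
  card_le_card fun _ hS ↦ mem_filter.2 ⟨mem_univ _, (mem_filter.1 hS).2.cliques_succ⟩

theorem card_cliques_succ_le_choose {s t : ℕ} (hs : 1 ≤ s) (hst : s ≤ t)
    {H : Finset (Finset V)} (hH : IsLGraph s H) (hcard : H.card ≤ t.choose s) :
    (cliques H s (s + 1)).card ≤ t.choose (s + 1) := by
  have h1 := (card_cliques_succ hs hst hH hcard).1
  have h2 := Nat.mul_le_mul_left (t - s) hcard
  have h3 := Nat.choose_succ_right_eq t s
  exact Nat.le_of_mul_le_mul_left (c := s + 1) (by linarith) (by omega)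

theorem choose_le_card_of_choose_le_cliques {m t : ℕ} (hmt : m ≤ t) (j : ℕ) :
    ∀ {s : ℕ}, s + j = m → 1 ≤ s → ∀ {H : Finset (Finset V)}, IsLGraph s H →
    H.card ≤ t.choose s → t.choose m ≤ (cliques H s m).card → t.choose s ≤ H.card := by
  induction j with
  | zero =>
    rintro s rfl _ H _ _ h
    refine h.trans (card_le_card fun S hS ↦ ?_)
    obtain ⟨h1, h2⟩ := (mem_filter.1 hS).2
    exact h2 S Subset.rfl h1
  | succ j ih =>
    intro s hsm hs H hH hcard h
    have h1 := ih (s := s + 1) (by omega) (by omega) (isLGraph_cliques H s (s + 1))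
      (card_cliques_succ_le_choose hs (by omega) hH hcard)
      (h.trans (card_cliques_le_cliques_succ H s m))
    have h2 := (card_cliques_succ hs (by omega) hH hcard).1
    have h3 := Nat.choose_succ_right_eq t s
    have h4 := Nat.mul_le_mul_left (s + 1) h1
    exact Nat.le_of_mul_le_mul_left (c := t - s) (by linarith) (by omega)

/-- The equality case of the clique form of the Kruskal-Katona theorem. -/
theorem eq_powersetCard_of_choose_le_cliques {s m t : ℕ} (hs : 1 ≤ s) (hsm : s < m) (hmt : m ≤ t)
    {H : Finset (Finset V)} (hH : IsLGraph s H) (hcard : H.card ≤ t.choose s)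
    (h : t.choose m ≤ (cliques H s m).card) :
    ∃ N : Finset V, N.card = t ∧ H = powersetCard s N := by
  have h1 := choose_le_card_of_choose_le_cliques hmt (m - (s + 1)) (s := s + 1) (by omega)
    (by omega) (isLGraph_cliques H s (s + 1))
    (card_cliques_succ_le_choose hs (by omega) hH hcard)
    (h.trans (card_cliques_le_cliques_succ H s m))
  have hcard' := choose_le_card_of_choose_le_cliques hmt (m - s) (by omega) hs hH hcard h
  obtain ⟨h2, h3⟩ := card_cliques_succ hs (by omega : s ≤ t) hH hcard
  have h4 := Nat.choose_succ_right_eq t s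
  have h5 := Nat.mul_le_mul_left (s + 1) h1
  have h6 := Nat.mul_le_mul_left (t - s) hcard
  refine (h3 (by linarith)).resolve_left ?_
  rintro rfl
  have := Nat.choose_pos (by omega : s ≤ t)
  simp at hcard'
  omega

/-- Every vertex in `C(t, k-1)` copies of `K_k^ℓ` has degree at least `C(t, ℓ-1)`, with equality
only if it lies in a copy of `K_{t+1}^ℓ`. -/
theorem min_degree {k ℓ t : ℕ} (hl : 2 ≤ ℓ) (hkl : ℓ < k) (hkt : k ≤ t + 1)
    {E : Finset (Finset V)} (hu : IsLGraph ℓ E) {v : V}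
    (hd : t.choose (k - 1) ≤ copiesAt E ℓ k v) :
    t.choose (ℓ - 1) ≤ (E.filter fun e ↦ v ∈ e).card ∧
    ((E.filter fun e ↦ v ∈ e).card = t.choose (ℓ - 1) →
      ∃ A : Finset V, v ∈ A ∧ IsCopy E ℓ (t + 1) A) := by
  obtain ⟨s, rfl⟩ : ∃ s, ℓ = s + 1 := ⟨ℓ - 1, by omega⟩
  obtain ⟨m, rfl⟩ : ∃ m, k = m + 1 := ⟨k - 1, by omega⟩
  simp only [Nat.add_sub_cancel] at hd ⊢
  have hcop : copiesAt E (s + 1) (m + 1) v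
      = ((cliques E (s + 1) (m + 1)).filter fun S ↦ v ∈ S).card := by
    unfold copiesAt cliques
    congr 1
    ext S
    simp [and_comm]
  rw [hcop] at hd
  have hmain : (E.filter fun e ↦ v ∈ e).card ≤ t.choose s →
      ∃ N : Finset V, N.card = t ∧ link E v = powersetCard s N := fun h ↦
    eq_powersetCard_of_choose_le_cliques (by omega) (by omega : s < m) (by omega)
      (isLGraph_link hu v) (by rwa [card_link]) (hd.trans (card_cliques_mem_le_link E s m v))
  constructor
  · by_contra! h
    obtain ⟨N, hN, hlink⟩ := hmain h.le
    have := congrArg card hlink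
    rw [card_link, card_powersetCard, hN] at this
    omega
  intro h
  obtain ⟨N, hN, hlink⟩ := hmain h.le
  have hall : link (cliques E (s + 1) (m + 1)) v = powersetCard m N := by
    refine eq_of_subset_of_card_le (fun T hT ↦ ?_) ?_
    · obtain ⟨hv, hT⟩ := mem_link.1 hT
      have := ((mem_filter.1 hT).2).erase_link (mem_insert_self v T)
      rw [erase_insert hv, hlink] at this
      exact mem_powersetCard.2 ⟨isCopy_powersetCard (by omega) (by omega) this, this.1⟩
    · rwa [card_powersetCard, hN, card_link]
  have hvN : v ∉ N := by
    intro hv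
    obtain ⟨e, hve, heN, he⟩ := exists_subsuperset_card_eq (singleton_subset_iff.2 hv)
      (by simp; omega : _ ≤ s) (by omega)
    have : e ∈ link E v := hlink ▸ mem_powersetCard.2 ⟨heN, he⟩
    exact (mem_link.1 this).1 (hve (mem_singleton_self v))
  refine ⟨insert v N, mem_insert_self v N, by rw [card_insert_of_notMem hvN, hN], ?_⟩
  intro e he hc
  by_cases hve : v ∈ e
  · have : e.erase v ∈ link E v := by
      rw [hlink, mem_powersetCard, card_erase_of_mem hve, hc]
      exact ⟨subset_insert_iff.1 he, rfl⟩
    rw [mem_link, insert_erase hve] at this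
    exact this.2
  · obtain ⟨T, heT, hTN, hT⟩ := exists_subsuperset_card_eq
      ((subset_insert_iff_of_notMem hve).1 he) (by omega : _ ≤ m) (by omega)
    have : T ∈ link (cliques E (s + 1) (m + 1)) v := hall ▸ mem_powersetCard.2 ⟨hTN, hT⟩
    exact (mem_filter.1 (mem_link.1 this).2).2.2 e (heT.trans (subset_insert v T)) hc

theorem degCond_of_cover {k ℓ t : ℕ} {E : Finset (Finset V)}
    (h : ∀ v, ∃ B : Finset V, v ∈ B ∧ IsCopy E ℓ (t + 1) B) (hk : 1 ≤ k) :
    DegCond E ℓ k t := by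
  intro v
  obtain ⟨B, hvB, hB⟩ := h v
  have h1 := card_powersetCard_filter_superset (singleton_subset_iff.2 hvB) (m := k) (by simpa)
  rw [card_singleton, hB.1, Nat.add_sub_cancel] at h1
  rw [← h1]
  refine card_le_card fun S hS ↦ ?_
  obtain ⟨hS, hv⟩ := mem_filter.1 hS
  obtain ⟨hS, hc⟩ := mem_powersetCard.1 hS
  exact mem_filter.2 ⟨mem_univ _, singleton_subset_iff.1 hv, hc,
    fun e he ↦ hB.2 e (he.trans hS)⟩

/-- If every vertex of minimum degree outside the copy `A` of `K_{t+1}^ℓ` lies in another copy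
meeting `A`, then the number of vertices outside `A` is at most the total degree excess. -/
theorem card_le_of_meets {ℓ t : ℕ} (hl : 2 ≤ ℓ) {E : Finset (Finset V)} (hu : IsLGraph ℓ E)
    {A : Finset V} (hA : IsCopy E ℓ (t + 1) A) (hc : ℓ - 1 ≤ (t - 1).choose (ℓ - 2))
    (hmin : ∀ x, t.choose (ℓ - 1) ≤ (E.filter fun e ↦ x ∈ e).card)
    (hmeet : ∀ u ∉ A, (E.filter fun e ↦ u ∈ e).card = t.choose (ℓ - 1) →
      ∃ B : Finset V, u ∈ B ∧ IsCopy E ℓ (t + 1) B ∧ ¬Disjoint A B) :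
    Fintype.card V * (t.choose (ℓ - 1) + 1) ≤ ℓ * E.card + (t + 1) := by
  set L : Finset V := Aᶜ.filter fun u ↦ (E.filter fun e ↦ u ∈ e).card = t.choose (ℓ - 1) with hL
  set F := E.filter fun e ↦ ¬Disjoint e A ∧ ¬e ⊆ A with hF
  have hLF : L.card ≤ F.card := by
    refine Nat.le_of_mul_le_mul_right (c := ℓ - 1) ?_ (by omega)
    refine card_mul_le_card_mul (fun u e ↦ u ∈ e) (fun u hu' ↦ ?_) (fun e he ↦ ?_)
    · obtain ⟨huA, hud⟩ := mem_filter.1 hu'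
      rw [mem_compl] at huA
      obtain ⟨B, huB, hB, hAB⟩ := hmeet u huA hud
      obtain ⟨x, hxA, hxB⟩ := not_disjoint_iff.1 hAB
      have hux : u ≠ x := fun h ↦ huA (h ▸ hxA)
      have h1 := card_powersetCard_filter_superset (T := {u, x}) (S := B)
        (by simp [insert_subset_iff, huB, hxB]) (m := ℓ) (by rwa [card_pair hux])
      rw [card_pair hux, hB.1, show t + 1 - 2 = t - 1 by omega] at h1
      rw [h1.symm] at hc
      refine hc.trans (card_le_card fun e he ↦ ?_)
      obtain ⟨he, hT⟩ := mem_filter.1 he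
      obtain ⟨he, hce⟩ := mem_powersetCard.1 he
      have hue : u ∈ e := hT (by simp)
      have hxe : x ∈ e := hT (by simp)
      exact mem_filter.2 ⟨mem_filter.2 ⟨hB.2 e he hce,
        not_disjoint_iff.2 ⟨x, hxe, hxA⟩, fun h ↦ huA (h hue)⟩, hue⟩
    · obtain ⟨he, hdis, -⟩ := mem_filter.1 he
      obtain ⟨x, hxe, hxA⟩ := not_disjoint_iff.1 hdis
      have : bipartiteBelow (fun u e ↦ u ∈ e) L e ⊆ e.erase x := by
        intro u hu'
        obtain ⟨huL, hue⟩ := mem_filter.1 hu'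
        have huA := (mem_filter.1 huL).1
        rw [mem_compl] at huA
        exact mem_erase.2 ⟨fun h ↦ huA (h ▸ hxA), hue⟩
      exact (card_le_card this).trans (by rw [card_erase_of_mem hxe, hu e he])
  have hinside : (t + 1) * t.choose (ℓ - 1) + F.card
      ≤ ∑ x ∈ A, (E.filter fun e ↦ x ∈ e).card := by
    have h1 : ∀ x ∈ A, t.choose (ℓ - 1) + (F.filter fun e ↦ x ∈ e).card
        ≤ (E.filter fun e ↦ x ∈ e).card := by
      intro x hx
      have h2 := card_powersetCard_filter_superset (singleton_subset_iff.2 hx) (m := ℓ)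
        (by rw [card_singleton]; omega)
      rw [card_singleton, hA.1, Nat.add_sub_cancel] at h2
      rw [← h2, ← card_union_of_disjoint]
      · refine card_le_card (union_subset (fun e he ↦ ?_) fun e he ↦ ?_)
        · obtain ⟨he, hT⟩ := mem_filter.1 he
          obtain ⟨he, hce⟩ := mem_powersetCard.1 he
          exact mem_filter.2 ⟨hA.2 e he hce, singleton_subset_iff.1 hT⟩
        · obtain ⟨he, hx⟩ := mem_filter.1 he
          exact mem_filter.2 ⟨(mem_filter.1 he).1, hx⟩
      · refine disjoint_left.2 fun e he he' ↦ ?_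
        exact (mem_filter.1 (mem_filter.1 he').1).2.2 (mem_powersetCard.1 (mem_filter.1 he).1).1
    have h3 := sum_le_sum h1
    rw [sum_add_distrib, sum_const, smul_eq_mul, hA.1] at h3
    have h4 : F.card ≤ ∑ x ∈ A, (F.filter fun e ↦ x ∈ e).card := by
      have := sum_card_bipartiteAbove_eq_sum_card_bipartiteBelow
        (s := A) (t := F) (fun v e ↦ v ∈ e)
      simp only [bipartiteAbove, bipartiteBelow] at this
      rw [this, card_eq_sum_ones]
      refine sum_le_sum fun e he ↦ card_pos.2 ?_
      obtain ⟨x, hxe, hxA⟩ := not_disjoint_iff.1 (mem_filter.1 he).2.1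
      exact ⟨x, mem_filter.2 ⟨hxA, hxe⟩⟩
    omega
  have houtside : Aᶜ.card * (t.choose (ℓ - 1) + 1)
      ≤ ∑ x ∈ Aᶜ, (E.filter fun e ↦ x ∈ e).card + L.card := by
    rw [hL, card_filter, ← sum_add_distrib, ← smul_eq_mul, ← sum_const]
    refine sum_le_sum fun x _ ↦ ?_
    have := hmin x
    split_ifs <;> omega
  have htot := sum_card_filter_mem hu
  rw [← sum_add_sum_compl A] at htot
  have hV := card_add_card_compl A
  rw [hA.1] at hV
  rw [← hV]
  nlinarith

/-- An extremal `ℓ`-graph on many vertices contains two disjoint copies of `K_{t+1}^ℓ`. -/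
theorem exists_disjoint_copies {k ℓ t : ℕ} (hkl : ℓ < k) (hl : 2 ≤ ℓ) (ht : k + ℓ ≤ t)
    (hn : (((t + 1) ^ 2 * Nat.choose (t - 1) (ℓ - 2) : ℕ) : ℚ) / 4 + 2 * (t : ℚ) <
      (Fintype.card V : ℚ))
    {E : Finset (Finset V)} (hE : IsExtremal E ℓ k t) :
    ∃ A₁ A₂ : Finset V, Disjoint A₁ A₂ ∧
      IsCopy E ℓ (t + 1) A₁ ∧ IsCopy E ℓ (t + 1) A₂ := by
  by_contra hcon
  push Not at hcon
  obtain ⟨hu, hd, hmin⟩ := hE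
  have hc : ℓ - 1 ≤ (t - 1).choose (ℓ - 2) := by
    rcases Nat.lt_or_ge ℓ 3 with h | h
    · have : ℓ = 2 := by omega
      subst this
      simp
    · have h1 := Nat.choose_le_choose (ℓ - 2) (show ℓ - 1 ≤ t - 1 by omega)
      rwa [show ℓ - 2 = ℓ - 1 - 1 by omega, Nat.choose_symm (by omega), Nat.choose_one_right,
        show ℓ - 1 - 1 = ℓ - 2 by omega] at h1
  have hn' : (t + 1) ^ 2 * (t - 1).choose (ℓ - 2) + 8 * t < 4 * Fintype.card V := by
    rw [← Nat.cast_lt (α := ℚ)]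
    push_cast at hn ⊢
    linarith
  obtain ⟨E', hu', hcov, hcard⟩ := exists_sparse_cover (V := V) (t := t) hl univ
    (by rw [card_univ]; omega)
  have hle := hmin E' hu' (degCond_of_cover (fun v ↦ hcov v (mem_univ v)) (by omega))
  rw [card_univ] at hcard
  have hlink := fun v ↦ min_degree hl hkl (by omega : k ≤ t + 1) hu (hd v)
  have hsum := sum_card_filter_mem hu
  have hex : ∃ v, (E.filter fun e ↦ v ∈ e).card = t.choose (ℓ - 1) := by
    by_contra! h
    have : ∑ _v : V, (t.choose (ℓ - 1) + 1) ≤ ∑ v : V, (E.filter fun e ↦ v ∈ e).card :=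
      sum_le_sum fun v _ ↦ lt_of_le_of_ne (hlink v).1 (h v).symm
    rw [hsum, sum_const, smul_eq_mul, card_univ] at this
    nlinarith
  obtain ⟨v, hv⟩ := hex
  obtain ⟨A, -, hA⟩ := (hlink v).2 hv
  have key := card_le_of_meets hl hu hA hc (fun x ↦ (hlink x).1) fun u huA hud ↦ by
    obtain ⟨B, huB, hB⟩ := (hlink u).2 hud
    exact ⟨B, huB, hB, fun h ↦ hcon A B h hA hB⟩
  nlinarith


end

/-- An extremal `ℓ`-graph on `n > (1/4)(t+1)²C(t-1,ℓ-2) + 2t` vertices with no isolated copy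
of `K_{t+1}^ℓ` contains two disjoint copies of `K_{t+1}^ℓ`. -/
theorem stmt16 (k ℓ : ℕ) (hkl : ℓ < k) (hl : 2 ≤ ℓ) :
    ∃ t₀ : ℕ, ∀ t : ℕ, t₀ ≤ t →
      ∀ (V : Type) [DecidableEq V] [Fintype V],
      (((t + 1) ^ 2 * Nat.choose (t - 1) (ℓ - 2) : ℕ) : ℚ) / 4 + 2 * (t : ℚ) <
        (Fintype.card V : ℚ) →
      ∀ E : Finset (Finset V), IsExtremal E ℓ k t →
      (∀ A : Finset V, ¬IsIsolatedCopy E ℓ t A) →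
      ∃ A₁ A₂ : Finset V, Disjoint A₁ A₂ ∧
        IsCopy E ℓ (t + 1) A₁ ∧ IsCopy E ℓ (t + 1) A₂ := by
  exact ⟨k + ℓ, fun _ ht _ _ _ hn _ hE _ ↦ exists_disjoint_copies hkl hl ht hn hE⟩
end
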